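/- arXiv:2406.13620 — 2 statements merged into one kernel-verified Lean document; each statement's English description precedes it below -/
import Mathlib

section
/- Let v : 2^E → ℝ satisfy gross substitutes and let T1, T2, S0 ⊆ E be pairwise disjoint sets with |T1| = |T2| ≥ 1. Then for every j ∈ T1 one has v(T1|S0) + v(T2|S0) ≤ max_{j' ∈ T2} ( v((T1 ∪ {j'}) ∖ {j} | S0) + v((T2 ∪ {j}) ∖ {j'} | S0) ), where v(A|S0) = v(A ∪ S0) − v(S0). -/
open Finset

variable {E : Type*}

/-- Quasilinear utility of bundle `T` at prices `p`. -/
def qUtil [DecidableEq E] (v : Finset E → ℝ) (p : E → ℝ) (T : Finset E) : ℝ :=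
  v T - ∑ j ∈ T, p j

/-- `T` is a demanded set at prices `p`. -/
def Demands [DecidableEq E] (v : Finset E → ℝ) (p : E → ℝ) (T : Finset E) : Prop :=
  ∀ T' : Finset E, qUtil v p T' ≤ qUtil v p T

/-- Gross substitutes: if prices (weakly) increase, every demanded set keeps, inside some
new demanded set, all its items whose price did not change. -/
def GrossSubstitutes [DecidableEq E] (v : Finset E → ℝ) : Prop :=
  ∀ p p' : E → ℝ, (∀ j, p j ≤ p' j) →
    ∀ T : Finset E, Demands v p T →
      ∃ T' : Finset E, Demands v p' T' ∧ ∀ j ∈ T, p j = p' j → j ∈ T'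

/-- Gross substitutes passes to minors: contract `S` by a very low price, and delete everything
outside `S ∪ R` by a very high one. -/
theorem GrossSubstitutes.minor [Fintype E] [DecidableEq E] {v : Finset E → ℝ}
    (hv : GrossSubstitutes v) {S R : Finset E} (hSR : Disjoint S R) {p p' : E → ℝ}
    (hp : ∀ i, p i ≤ p' i) {T : Finset E} (hTR : T ⊆ R)
    (hT : ∀ U ⊆ R, qUtil (fun U => v (S ∪ U)) p U ≤ qUtil (fun U => v (S ∪ U)) p T) :
    ∃ T' ⊆ R, (∀ U ⊆ R, qUtil (fun U => v (S ∪ U)) p' U ≤ qUtil (fun U => v (S ∪ U)) p' T') ∧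
      ∀ i ∈ T, p i = p' i → i ∈ T' := by
  obtain ⟨K, hK⟩ : ∃ K : ℝ, ∀ A B, v A - v B < K := by
    obtain ⟨M, hM⟩ := (Set.finite_range v).bddAbove
    obtain ⟨m, hm⟩ := (Set.finite_range v).bddBelow
    refine ⟨M - m + 1, fun A B => ?_⟩
    have h1 := hM (Set.mem_range_self A)
    have h2 := hm (Set.mem_range_self B)
    linarith
  let ext : (E → ℝ) → E → ℝ := fun q i => if i ∈ S then -K else if i ∈ R then q i else K
  have ext_S : ∀ q, ∀ i ∈ S, ext q i = -K := fun q i hi => if_pos hi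
  have ext_R : ∀ q, ∀ i ∈ R, ext q i = q i := fun q i hi => by
    simp [ext, hi, Finset.disjoint_right.mp hSR hi]
  have ext_out : ∀ q i, i ∉ S → i ∉ R → ext q i = K := fun q i h1 h2 => by simp [ext, h1, h2]
  have util : ∀ q, ∀ U ⊆ R,
      qUtil v (ext q) (S ∪ U) = qUtil (fun U => v (S ∪ U)) q U - ∑ i ∈ S, ext q i := by
    intro q U hU
    unfold qUtil
    rw [Finset.sum_union (hSR.mono_right hU),
      Finset.sum_congr rfl fun i hi => ext_R q i (hU hi)]
    ring
  have between : ∀ q D, Demands v (ext q) D → ∃ U ⊆ R, D = S ∪ U := by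
    intro q D hD
    have hS : S ⊆ D := by
      intro i hi
      by_contra hiD
      have h1 := hD (insert i D)
      unfold qUtil at h1
      rw [Finset.sum_insert hiD, ext_S q i hi] at h1
      linarith [hK D (insert i D)]
    have hR : ∀ i ∈ D, i ∉ S → i ∈ R := by
      intro i hi hiS
      by_contra hiR
      have h1 := hD (D.erase i)
      unfold qUtil at h1
      rw [← Finset.add_sum_erase D _ hi, ext_out q i hiS hiR] at h1
      linarith [hK D (D.erase i)]
    refine ⟨D \ S, fun i hi => ?_, (Finset.union_sdiff_of_subset hS).symm⟩
    exact hR i (Finset.mem_sdiff.mp hi).1 (Finset.mem_sdiff.mp hi).2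
  have hdem : Demands v (ext p) (S ∪ T) := by
    obtain ⟨D, hD⟩ := Finite.exists_max (qUtil v (ext p))
    obtain ⟨U, hU, rfl⟩ := between p D hD
    intro T'
    have h1 := hD T'
    have h2 := hT U hU
    rw [util p U hU] at h1
    rw [util p T hTR]
    linarith
  have hle : ∀ i, ext p i ≤ ext p' i := by
    intro i
    simp only [ext]
    split_ifs <;> simp [hp]
  obtain ⟨D, hD, hDT⟩ := hv (ext p) (ext p') hle _ hdem
  obtain ⟨T', hT', rfl⟩ := between p' D hD
  refine ⟨T', hT', fun U hU => ?_, fun i hi hpi => ?_⟩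
  · have h1 := hD (S ∪ U)
    rw [util p' U hU, util p' T' hT'] at h1
    linarith
  · have h1 := hDT i (Finset.mem_union_right _ hi)
      (by rw [ext_R p i (hTR hi), ext_R p' i (hTR hi), hpi])
    exact (Finset.mem_union.mp h1).resolve_left (Finset.disjoint_right.mp hSR (hTR hi))

/-- Under gross substitutes, two bundles `T` and `T₀` with `2 ≤ #(T \ T₀)` cannot be the only
two optimal ones: raising the price of one item of `T \ T₀` would discard another. -/
theorem GrossSubstitutes.exists_other_optimal [Fintype E] [DecidableEq E] {v : Finset E → ℝ}
    (hv : GrossSubstitutes v) {S R : Finset E} (hSR : Disjoint S R) (p : E → ℝ)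
    {T T₀ : Finset E} (hT : T ⊆ R) (hT₀ : T₀ ⊆ R) {a b : E} (hab : a ≠ b)
    (haT : a ∈ T) (haT₀ : a ∉ T₀) (hbT : b ∈ T) (hbT₀ : b ∉ T₀)
    (heq : qUtil (fun U => v (S ∪ U)) p T = qUtil (fun U => v (S ∪ U)) p T₀) :
    ∃ U ⊆ R, U ≠ T ∧ U ≠ T₀ ∧
      qUtil (fun U => v (S ∪ U)) p T₀ ≤ qUtil (fun U => v (S ∪ U)) p U := by
  by_contra! hlt
  have hmax : ∀ U ⊆ R, qUtil (fun U => v (S ∪ U)) p U ≤ qUtil (fun U => v (S ∪ U)) p T := by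
    intro U hU
    by_cases h1 : U = T
    · rw [h1]
    by_cases h2 : U = T₀
    · rw [h2, heq]
    · exact heq ▸ (hlt U hU h1 h2).le
  let p' : E → ℝ := fun i => p i + if i = a then 1 else 0
  have util : ∀ U, qUtil (fun U => v (S ∪ U)) p' U =
      qUtil (fun U => v (S ∪ U)) p U - if a ∈ U then 1 else 0 := by
    intro U
    simp only [qUtil, p', Finset.sum_add_distrib, Finset.sum_ite_eq']
    ring
  obtain ⟨T', hT', hmax', hkeep⟩ := hv.minor hSR (p := p) (p' := p')
    (fun i => by simp only [p']; split_ifs <;> simp) hT hmax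
  have hb : b ∈ T' := hkeep b hbT (by simp [p', hab.symm])
  have h1 := hmax' T₀ hT₀
  rw [util, util, if_neg haT₀] at h1
  by_cases h2 : T' = T
  · rw [h2, if_pos haT] at h1
    linarith
  · have h3 := hlt T' hT' h2 (fun h => hbT₀ (h ▸ hb))
    split_ifs at h1 <;> linarith

theorem Finset.eq_or_eq_of_subset_pair [DecidableEq E] {a b : E} {U : Finset E}
    (hU : U ⊆ {a, b}) : U = ∅ ∨ U = {a} ∨ U = {b} ∨ U = {a, b} := by
  rw [← Finset.coe_subset, Finset.coe_pair, Set.subset_pair_iff_eq] at hU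
  exact_mod_cast hU

theorem Finset.eq_or_eq_of_subset_triple [DecidableEq E] {a b c : E} {U : Finset E}
    (hU : U ⊆ {a, b, c}) :
    U = ∅ ∨ U = {a} ∨ U = {b} ∨ U = {c} ∨ U = {a, b} ∨ U = {a, c} ∨ U = {b, c} ∨
      U = {a, b, c} := by
  have h := Finset.eq_or_eq_of_subset_pair (Finset.subset_insert_iff.mp hU)
  by_cases ha : a ∈ U
  · rw [← Finset.insert_erase ha]
    rcases h with h | h | h | h <;> simp [h]
  · rw [Finset.erase_eq_of_notMem ha] at h
    tauto

theorem GrossSubstitutes.submodular [Fintype E] [DecidableEq E] {v : Finset E → ℝ}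
    (hv : GrossSubstitutes v) {S : Finset E} {a b : E} (ha : a ∉ S) (hb : b ∉ S) (hab : a ≠ b) :
    v (S ∪ {a, b}) + v S ≤ v (S ∪ {a}) + v (S ∪ {b}) := by
  by_contra! hlt
  let p : E → ℝ := fun i =>
    if i = a then (v (S ∪ {a, b}) - v S + v (S ∪ {a}) - v (S ∪ {b})) / 2
    else (v (S ∪ {a, b}) - v S + v (S ∪ {b}) - v (S ∪ {a})) / 2
  have hpa : p a = (v (S ∪ {a, b}) - v S + v (S ∪ {a}) - v (S ∪ {b})) / 2 := if_pos rfl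
  have hpb : p b = (v (S ∪ {a, b}) - v S + v (S ∪ {b}) - v (S ∪ {a})) / 2 := if_neg hab.symm
  obtain ⟨U, hU, h1, h2, h3⟩ := hv.exists_other_optimal (S := S) (R := {a, b}) (by simp [ha, hb]) p
    (T := {a, b}) (T₀ := ∅) subset_rfl (by simp) hab (by simp) (by simp) (by simp) (by simp)
    (by simp only [qUtil, Finset.sum_pair hab, hpa, hpb, Finset.union_empty,
          Finset.sum_empty]; ring)
  have hcases : U = {a} ∨ U = {b} := by
    rcases Finset.eq_or_eq_of_subset_pair hU with h | h | h | h
    · exact absurd h h2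
    · exact .inl h
    · exact .inr h
    · exact absurd h h1
  rcases hcases with rfl | rfl <;>
    simp only [qUtil, Finset.sum_singleton, hpa, hpb, Finset.union_empty, Finset.sum_empty] at h3 <;>
    linarith

theorem GrossSubstitutes.triple_exchange [Fintype E] [DecidableEq E] {v : Finset E → ℝ}
    (hv : GrossSubstitutes v) {S : Finset E} {a b c : E} (ha : a ∉ S) (hb : b ∉ S) (hc : c ∉ S)
    (hab : a ≠ b) (hac : a ≠ c) (hbc : b ≠ c) :
    v (S ∪ {a, b}) + v (S ∪ {c}) ≤ v (S ∪ {a, c}) + v (S ∪ {b}) ∨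
      v (S ∪ {a, b}) + v (S ∪ {c}) ≤ v (S ∪ {b, c}) + v (S ∪ {a}) := by
  by_contra! hlt
  obtain ⟨hlt₁, hlt₂⟩ := hlt
  have hsub := hv.submodular ha hb hab
  have hsub' := hv.submodular (S := S ∪ {c}) (a := a) (b := b) (by simp [ha, hac])
    (by simp [hb, hbc]) hab
  have e1 : S ∪ {c} ∪ {a, b} = S ∪ {a, b, c} := by ext; simp; tauto
  have e2 : S ∪ {c} ∪ {a} = S ∪ {a, c} := by ext; simp; tauto
  have e3 : S ∪ {c} ∪ {b} = S ∪ {b, c} := by ext; simp; tauto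
  rw [e1, e2, e3] at hsub'
  set P := v (S ∪ {a, b}) - v (S ∪ {c}) with hP
  set Q := v (S ∪ {a, c}) - v (S ∪ {b}) with hQ
  set W := v (S ∪ {b, c}) - v (S ∪ {a}) with hW
  let p : E → ℝ := fun i =>
    if i = a then (P + Q) / 2 else if i = b then (P + W) / 2 else (Q + W) / 2
  have hpa : p a = (P + Q) / 2 := if_pos rfl
  have hpb : p b = (P + W) / 2 := by simp [p, hab.symm]
  have hpc : p c = (Q + W) / 2 := by simp [p, hac.symm, hbc.symm]
  obtain ⟨U, hU, h1, h2, h3⟩ := hv.exists_other_optimal (S := S) (R := {a, b, c})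
    (by simp [ha, hb, hc]) p (T := {a, b}) (T₀ := {c})
    (by intro i; simp; tauto) (by simp) hab (by simp) (by simpa using hac)
    (by simp) (by simpa using hbc)
    (by simp only [qUtil, Finset.sum_pair hab, Finset.sum_singleton, hpa, hpb, hpc]; linarith)
  have hsum : ∑ i ∈ ({a, b, c} : Finset E), p i = p a + (p b + p c) := by
    rw [Finset.sum_insert (by simp [hab, hac]), Finset.sum_pair hbc]
  rcases Finset.eq_or_eq_of_subset_triple hU with rfl | rfl | rfl | rfl | rfl | rfl | rfl | rfl
  case inr.inr.inr.inl => exact h2 rfl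
  case inr.inr.inr.inr.inl => exact h1 rfl
  all_goals
    simp only [qUtil, hsum, Finset.sum_pair hac, Finset.sum_pair hbc, Finset.sum_singleton,
      Finset.sum_empty, Finset.union_empty, hpa, hpb, hpc] at h3
    linarith

theorem GrossSubstitutes.quadruple_exchange [Fintype E] [DecidableEq E] {v : Finset E → ℝ}
    (hv : GrossSubstitutes v) {S : Finset E} {a b c d : E}
    (ha : a ∉ S) (hb : b ∉ S) (hc : c ∉ S) (hd : d ∉ S)
    (hab : a ≠ b) (hac : a ≠ c) (had : a ≠ d) (hbc : b ≠ c) (hbd : b ≠ d) (hcd : c ≠ d) :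
    v (S ∪ {a, b}) + v (S ∪ {c, d}) ≤ v (S ∪ {a, c}) + v (S ∪ {b, d}) ∨
      v (S ∪ {a, b}) + v (S ∪ {c, d}) ≤ v (S ∪ {a, d}) + v (S ∪ {b, c}) := by
  by_contra! hlt
  obtain ⟨hlt₁, hlt₂⟩ := hlt
  have h1 := hv.triple_exchange ha hb hc hab hac hbc
  have h2 := hv.triple_exchange ha hb hd hab had hbd
  have h3 := hv.triple_exchange hc hd ha hcd hac.symm had.symm
  have h4 := hv.triple_exchange hc hd hb hcd hbc.symm hbd.symm
  rw [Finset.pair_comm c a, Finset.pair_comm d a] at h3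
  rw [Finset.pair_comm c b, Finset.pair_comm d b] at h4
  rcases h1 with h1 | h1 <;> rcases h2 with h2 | h2 <;> rcases h3 with h3 | h3 <;>
    rcases h4 with h4 | h4 <;> linarith

theorem GrossSubstitutes.two_swaps [Fintype E] [DecidableEq E] {v : Finset E → ℝ}
    (hv : GrossSubstitutes v) {Y : Finset E} {x x' y y' : E} (hy : y ∈ Y) (hy' : y' ∈ Y)
    (hyy' : y ≠ y') (hx : x ∉ Y) (hx' : x' ∉ Y) (hxx' : x ≠ x') :
    v Y + v (insert x ((insert x' (Y.erase y')).erase y)) ≤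
        v (insert x (Y.erase y')) + v (insert x' (Y.erase y)) ∨
      v Y + v (insert x ((insert x' (Y.erase y')).erase y)) ≤
        v (insert x' (Y.erase y')) + v (insert x (Y.erase y)) := by
  have hyx : y ≠ x := ne_of_mem_of_not_mem hy hx
  have hyx' : y ≠ x' := ne_of_mem_of_not_mem hy hx'
  have hy'x : y' ≠ x := ne_of_mem_of_not_mem hy' hx
  have hy'x' : y' ≠ x' := ne_of_mem_of_not_mem hy' hx'
  have hloc := hv.quadruple_exchange (S := (Y.erase y').erase y) (a := y) (b := y') (c := x)
    (d := x') (by simp) (by simp) (by simp [hx]) (by simp [hx']) hyy' hyx hyx' hy'x hy'x' hxx'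
  have e1 : (Y.erase y').erase y ∪ {y, y'} = Y := by grind
  have e2 : (Y.erase y').erase y ∪ {x, x'} = insert x ((insert x' (Y.erase y')).erase y) := by
    grind
  have e3 : (Y.erase y').erase y ∪ {y, x} = insert x (Y.erase y') := by grind
  have e4 : (Y.erase y').erase y ∪ {y', x'} = insert x' (Y.erase y) := by grind
  have e5 : (Y.erase y').erase y ∪ {y, x'} = insert x' (Y.erase y') := by grind
  have e6 : (Y.erase y').erase y ∪ {y', x} = insert x (Y.erase y) := by grind
  rwa [e1, e2, e3, e4, e5, e6] at hloc

/-- Exchange property between bundles of equal size. -/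
theorem GrossSubstitutes.exchange [Fintype E] [DecidableEq E] {v : Finset E → ℝ}
    (hv : GrossSubstitutes v) {X Y : Finset E} (hXY : X.card = Y.card)
    {x : E} (hxX : x ∈ X) (hxY : x ∉ Y) :
    ∃ y ∈ Y \ X, v X + v Y ≤ v (insert y (X.erase x)) + v (insert x (Y.erase y)) := by
  obtain ⟨n, hn⟩ : ∃ n, (X \ Y).card = n := ⟨_, rfl⟩
  induction n generalizing Y with
  | zero =>
    rw [Finset.card_eq_zero, Finset.sdiff_eq_empty_iff_subset] at hn
    exact absurd (hn hxX) hxY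
  | succ n ih =>
    have hcard : (Y \ X).card = n + 1 := by rw [← hn, Finset.card_sdiff_comm hXY]
    by_cases hx' : ∃ x' ∈ X \ Y, x' ≠ x
    · obtain ⟨x', hx', hne⟩ := hx'
      obtain ⟨hx'X, hx'Y⟩ := Finset.mem_sdiff.mp hx'
      by_contra! hlt
      obtain ⟨y', hy', hmax⟩ := Finset.exists_max_image (Y \ X)
        (fun y => v (insert x' (Y.erase y)) + v (insert y (X.erase x)))
        (Finset.card_pos.mp (by omega))
      obtain ⟨hy'Y, hy'X⟩ := Finset.mem_sdiff.mp hy'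
      have hsd : X \ insert x' (Y.erase y') = (X \ Y).erase x' := by
        ext i
        simp only [Finset.mem_sdiff, Finset.mem_insert, Finset.mem_erase]
        by_cases h : i = y'
        · subst h; simp [hy'X]
        · tauto
      obtain ⟨y, hy, hle⟩ := ih (Y := insert x' (Y.erase y'))
        (by rw [Finset.card_insert_of_notMem (by simp [hx'Y]), Finset.card_erase_add_one hy'Y, hXY])
        (by simp [hne.symm, hxY])
        (by rw [hsd, Finset.card_erase_of_mem hx', hn]; rfl)
      have hyX : y ∉ X := (Finset.mem_sdiff.mp hy).2
      have hyx' : y ≠ x' := fun h => hyX (h ▸ hx'X)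
      obtain ⟨hyy', hyY⟩ : y ≠ y' ∧ y ∈ Y := by simpa [hyx', hyX] using hy
      have hloc := hv.two_swaps hyY hy'Y hyy' hxY hx'Y hne.symm
      have h1 := hlt y (Finset.mem_sdiff.mpr ⟨hyY, hyX⟩)
      have h2 := hlt y' hy'
      have h3 := hmax y (Finset.mem_sdiff.mpr ⟨hyY, hyX⟩)
      rcases hloc with h | h <;> linarith
    · push Not at hx'
      have hX : X \ Y = {x} := Finset.eq_singleton_iff_unique_mem.mpr
        ⟨Finset.mem_sdiff.mpr ⟨hxX, hxY⟩, hx'⟩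
      have hn0 : n = 0 := by simpa [hX] using hn.symm
      obtain ⟨y, hY⟩ := Finset.card_eq_one.mp (hn0 ▸ hcard : (Y \ X).card = 0 + 1)
      have key : ∀ i, (i ∈ X ∧ i ∉ Y ↔ i = x) ∧ (i ∈ Y ∧ i ∉ X ↔ i = y) := fun i =>
        ⟨by rw [← Finset.mem_sdiff, hX, Finset.mem_singleton],
          by rw [← Finset.mem_sdiff, hY, Finset.mem_singleton]⟩
      have e1 : insert y (X.erase x) = Y := by ext i; simp; grind
      have e2 : insert x (Y.erase y) = X := by ext i; simp; grind
      refine ⟨y, by simp [hY], ?_⟩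
      rw [e1, e2, add_comm]

/-- Fujishige–Yang exchange property for gross substitutes valuations. -/
theorem grossSubstitutes_pair_exchange
    [Fintype E] [DecidableEq E] (v : Finset E → ℝ) (hv : GrossSubstitutes v)
    (T1 T2 S0 : Finset E)
    (h12 : Disjoint T1 T2) (h10 : Disjoint T1 S0) (h20 : Disjoint T2 S0)
    (hcard : T1.card = T2.card) (hpos : 1 ≤ T1.card)
    (j : E) (hj : j ∈ T1) :
    ∃ j' ∈ T2,
      (v (T1 ∪ S0) - v S0) + (v (T2 ∪ S0) - v S0) ≤
        (v ((insert j' (T1.erase j)) ∪ S0) - v S0) +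
          (v ((insert j (T2.erase j')) ∪ S0) - v S0) := by
  have hjT2 := Finset.disjoint_left.mp h12 hj
  have hjS0 := Finset.disjoint_left.mp h10 hj
  obtain ⟨y, hy, hle⟩ := hv.exchange (X := T1 ∪ S0) (Y := T2 ∪ S0) (x := j)
    (by rw [Finset.card_union_of_disjoint h10, Finset.card_union_of_disjoint h20, hcard])
    (by simp [hj]) (by simp [hjT2, hjS0])
  simp only [Finset.mem_sdiff, Finset.mem_union, not_or] at hy
  obtain ⟨hy, -, hyS0⟩ := hy
  have hyT2 : y ∈ T2 := hy.resolve_right hyS0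
  refine ⟨y, hyT2, ?_⟩
  rw [Finset.erase_union_distrib, Finset.erase_union_distrib, Finset.erase_eq_of_notMem hjS0,
    Finset.erase_eq_of_notMem hyS0, ← Finset.insert_union, ← Finset.insert_union] at hle
  linarith
end

section
/- Consider the following NQ-model instance built from integer knapsack data: a finite set S of items with integer values w_j ≥ 0, integer costs c_j ≥ 1, and an integer budget C ≥ 1; each item j has capacity cap(j) = 2; for each item j there are three quasilinear unit-value buyers i_j^1, i_j^2, i_j^3 with additive valuations v_{i_j^ℓ}({j}) = c_j and v_{i_j^ℓ}({j'}) = 0 for j' ≠ j, and utility u(T,p) = v(T) − Σ_{j∈T} p_j; and one main buyer i_0 with valuation v_{i_0}(T) = Σ_{j∈T} w_j and utility u_{i_0}(T,p) = v_{i_0}(T) − r(Σ_{j∈T} p_j), where r(x) = x/(2C) for x ≤ C and r(x) = 1/2 + (1 + Σ_{j∈S} w_j)(x − C) for x > C. Then in every competitive equilibrium (μ, p) of this instance: p_j = c_j for every item j, and μ(i_0) is an optimal solution of the knapsack problem, i.e., Σ_{j∈μ(i_0)} c_j ≤ C and Σ_{j∈μ(i_0)} w_j ≥ Σ_{j∈T}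 w_j for every T ⊆ S with Σ_{j∈T} c_j ≤ C. -/
open Finset

variable {S : Type*}

/-- The main buyer's value-for-money function: linear with small slope up to the budget
`C`, then steeply increasing. -/
noncomputable def rKnap [Fintype S] (w : S → ℕ) (C : ℕ) (x : ℝ) : ℝ :=
  if x ≤ (C : ℝ) then x / (2 * C)
  else 1 / 2 + (1 + ∑ j : S, (w j : ℝ)) * (x - C)

/-- Utility of the buyers in the knapsack instance of the NQ model: `some (j, ℓ)` is the
`ℓ`-th auxiliary quasilinear buyer for item `j`, valuing only item `j` at its knapsack
cost; `none` is the main buyer, with additive valuation given by the knapsack values and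
the non-quasilinear value-for-money function `rKnap`. -/
noncomputable def uKnap [Fintype S] [DecidableEq S] (w c : S → ℕ) (C : ℕ)
    (i : Option (S × Fin 3)) (p : S → ℝ) (T : Finset S) : ℝ :=
  match i with
  | some (j, _) => (if j ∈ T then (c j : ℝ) else 0) - ∑ j' ∈ T, p j'
  | none => (∑ j ∈ T, (w j : ℝ)) - rKnap w C (∑ j ∈ T, p j)

/-- Items matched to buyer `i`. -/
def mmItems [DecidableEq S] (μ : Finset (Option (S × Fin 3) × S))
    (i : Option (S × Fin 3)) : Finset S :=
  (μ.filter fun e => e.1 = i).image Prod.snd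

section Auxiliary

variable [DecidableEq S]

theorem mem_mmItems {μ : Finset (Option (S × Fin 3) × S)} {i : Option (S × Fin 3)} {j : S} :
    j ∈ mmItems μ i ↔ (i, j) ∈ μ := by
  simp [mmItems]

variable [Fintype S] {w c : S → ℕ} {C : ℕ} {p : S → ℝ}

/-- An auxiliary buyer's demanded bundle contains its own item when that item is priced
below its cost. -/
theorem mem_of_price_lt_of_demand {j : S} {l : Fin 3} {M : Finset S}
    (hM : ∀ T, uKnap w c C (some (j, l)) p T ≤ uKnap w c C (some (j, l)) p M)
    (hj : p j < c j) : j ∈ M := by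
  by_contra hjM
  have h := hM (insert j M)
  simp only [uKnap, hjM, mem_insert_self, if_true, if_false, sum_insert hjM] at h
  linarith

/-- An auxiliary buyer's demanded bundle contains no item priced above the buyer's value
for it. -/
theorem notMem_of_lt_price_of_demand {j k : S} {l : Fin 3} {M : Finset S}
    (hM : ∀ T, uKnap w c C (some (j, l)) p T ≤ uKnap w c C (some (j, l)) p M)
    (hk : (c k : ℝ) < p k) : k ∉ M := by
  intro hkM
  have h := hM (M.erase k)
  simp only [uKnap, mem_erase, ← add_sum_erase M p hkM] at h
  have hc : (0 : ℝ) ≤ c k := Nat.cast_nonneg _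
  by_cases hjk : j = k
  · subst hjk
    simp only [ne_eq, not_true_eq_false, false_and, if_false, hkM, if_true] at h
    linarith
  · simp only [ne_eq, hjk, not_false_eq_true, true_and] at h
    linarith

theorem price_eq_cost_of_equilibrium {μ : Finset (Option (S × Fin 3) × S)}
    (hcap : ∀ j : S, (μ.filter fun e => e.2 = j).card ≤ 2)
    (hfeas : ∀ j : S, (μ.filter fun e => e.2 = j).card < 2 → p j = 0)
    (hCE : ∀ (i : Option (S × Fin 3)) (T : Finset S),
      uKnap w c C i p T ≤ uKnap w c C i p (mmItems μ i)) (j : S) :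
    p j = c j := by
  rcases lt_trichotomy (p j) (c j) with h | h | h
  · have hsub : (univ.image fun l : Fin 3 => ((some (j, l) : Option (S × Fin 3)), j)) ⊆
        μ.filter fun e => e.2 = j := by
      intro e he
      obtain ⟨l, -, rfl⟩ := mem_image.1 he
      exact mem_filter.2 ⟨mem_mmItems.1 (mem_of_price_lt_of_demand (hCE (some (j, l))) h), rfl⟩
    have hcard := card_le_card hsub
    rw [card_image_of_injective _ (fun a b hab => by simpa using hab), card_univ,
      Fintype.card_fin] at hcard
    have := hcap j
    omega
  · exact h
  · have hsub : (μ.filter fun e => e.2 = j) ⊆ {(none, j)} := by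
      rintro ⟨i, k⟩ he
      obtain ⟨hmem, rfl⟩ := mem_filter.1 he
      rcases i with _ | ⟨j', l⟩
      · simp
      · exact absurd (mem_mmItems.2 hmem) (notMem_of_lt_price_of_demand (hCE _) h)
    have hcard := card_le_card hsub
    rw [card_singleton] at hcard
    have h0 := hfeas j (by omega)
    have hc : (0 : ℝ) ≤ c j := Nat.cast_nonneg _
    linarith

/-- At prices equal to the costs, the main buyer does not exceed the budget. -/
theorem cost_le_budget_of_demand {M : Finset S}
    (hM : ∀ T, uKnap w c C none (fun j => (c j : ℝ)) T ≤
      uKnap w c C none (fun j => (c j : ℝ)) M) :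
    ∑ j ∈ M, (c j : ℝ) ≤ C := by
  by_contra! h
  have h0 := hM ∅
  have hint : (C : ℝ) + 1 ≤ ∑ j ∈ M, (c j : ℝ) := by exact_mod_cast h
  have hle : ∑ j ∈ M, (w j : ℝ) ≤ ∑ j, (w j : ℝ) :=
    sum_le_sum_of_subset_of_nonneg (subset_univ M) fun _ _ _ => Nat.cast_nonneg _
  have hpos : (0 : ℝ) ≤ ∑ j, (w j : ℝ) := sum_nonneg fun _ _ => Nat.cast_nonneg _
  simp only [uKnap, rKnap, sum_empty, Nat.cast_nonneg, if_true, not_le.2 h, if_false,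
    zero_div] at h0
  nlinarith

/-- At prices equal to the costs, the main buyer's bundle has maximum value among all
bundles within the budget. -/
theorem value_le_of_demand (hC : 1 ≤ C) {M T : Finset S}
    (hM : ∀ T, uKnap w c C none (fun j => (c j : ℝ)) T ≤
      uKnap w c C none (fun j => (c j : ℝ)) M)
    (hT : ∑ j ∈ T, (c j : ℝ) ≤ C) :
    ∑ j ∈ T, (w j : ℝ) ≤ ∑ j ∈ M, (w j : ℝ) := by
  by_contra! h
  have h0 := hM T
  simp only [uKnap, rKnap, hT, cost_le_budget_of_demand hM, if_true] at h0
  have hC' : (0 : ℝ) < 2 * C := by positivity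
  have hT' : (∑ j ∈ T, (c j : ℝ)) / (2 * C) ≤ 1 / 2 := by
    rw [div_le_iff₀ hC']
    linarith
  have hM' : 0 ≤ (∑ j ∈ M, (c j : ℝ)) / (2 * C) := by positivity
  have hint : ∑ j ∈ M, (w j : ℝ) + 1 ≤ ∑ j ∈ T, (w j : ℝ) := by exact_mod_cast h
  linarith

end Auxiliary

/-- In every competitive equilibrium of the NQ-model instance built from integer
knapsack data, prices equal the knapsack costs and the main buyer receives an optimal
knapsack solution. -/
theorem knapsack_instance_equilibrium
    [Fintype S] [DecidableEq S]
    (w c : S → ℕ) (C : ℕ) (hc : ∀ j, 1 ≤ c j) (hC : 1 ≤ C)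
    (μ : Finset (Option (S × Fin 3) × S)) (p : S → ℝ)
    (hp : ∀ j, 0 ≤ p j)
    (hcap : ∀ j : S, (μ.filter fun e => e.2 = j).card ≤ 2)
    (hfeas : ∀ j : S, (μ.filter fun e => e.2 = j).card < 2 → p j = 0)
    (hCE : ∀ (i : Option (S × Fin 3)) (T : Finset S),
      uKnap w c C i p T ≤ uKnap w c C i p (mmItems μ i)) :
    (∀ j : S, p j = (c j : ℝ)) ∧
    (∑ j ∈ mmItems μ none, (c j : ℝ)) ≤ (C : ℝ) ∧
    (∀ T : Finset S, (∑ j ∈ T, (c j : ℝ)) ≤ (C : ℝ) →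
      ∑ j ∈ T, (w j : ℝ) ≤ ∑ j ∈ mmItems μ none, (w j : ℝ)) := by
  have hpc : p = fun j => (c j : ℝ) := funext (price_eq_cost_of_equilibrium hcap hfeas hCE)
  subst hpc
  exact ⟨fun _ => rfl, cost_le_budget_of_demand (hCE none),
    fun _ hT => value_le_of_demand hC (hCE none) hT⟩
end
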